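/- Differentiability Lemma: Let H be a real Hilbert space, f : H → ℝ Lipschitz, and (x,e) ∈ H × S(H) with the directional derivative f'(x,e) existing and non-negative. Suppose there is a family of sets {F_ε ⊆ H : ε > 0} such that: (1) for all ε, η > 0 there is δ* > 0 so that for any δ ∈ (0, δ*) and any u₁, u₂, u₃ in the closed unit ball there exist u₁', u₂', u₃' with ‖u_m' − u_m‖ ≤ η and [x+δu₁', x+δu₃'] ∪ [x+δu₃', x+δu₂'] ⊆ F_ε; (2) whenever x' ∈ F_ε and e' is a unit vector such that f'(x',e') exists, f'(x',e') ≥ f'(x,e), and |(f(x'+te) − f(x')) − (f(x+te) − f(x))| ≤ 25√((f'(x',e') − f'(x,e)) Lip(f)) |t| for all t, then f'(x',e') < f'(x,e) + ε. Then f is Fréchet differentiable at x with f'(x)(h) = f'(x,e)⟨h,e⟩. -/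

import Mathlib

open Filter

/-- The (two-sided) directional derivative: `f'(x,e) = lim_{t→0} (f(x+te)-f(x))/t = L`. -/
def HasDirDeriv {H : Type*} [NormedAddCommGroup H] [NormedSpace ℝ H]
    (f : H → ℝ) (x e : H) (L : ℝ) : Prop :=
  Tendsto (fun t : ℝ => (f (x + t • e) - f x) / t) (nhdsWithin 0 {0}ᶜ) (nhds L)

/-- The least Lipschitz constant `Lip(f)` of `f`. -/
noncomputable def lipConst {H : Type*} [NormedAddCommGroup H] (f : H → ℝ) : ℝ :=
  sInf {K : ℝ | 0 ≤ K ∧ ∀ x y, |f x - f y| ≤ K * ‖x - y‖}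

open MeasureTheory Set in
/-- A weak-type bound for the right-sided maximal slope of a Lipschitz function on an interval. -/
lemma volume_exists_slope_right_gt {g : ℝ → ℝ} {K : NNReal} (hg : LipschitzWith K g)
    {c b : ℝ} (hcb : c ≤ b) (a : ℝ) (ha : 0 ≤ a) :
    a * volume.real {τ ∈ Ioo c b | ∃ p ∈ Icc τ b, a * (p - τ) < g p - g τ} ≤
      ∫ x in Ioo c b, max (deriv g x) 0 := by
  obtain ⟨h, hh⟩ : ∃ h : ℝ → ℝ, h = fun x => g x - a * x := ⟨_, rfl⟩
  have hhlip : LipschitzWith (K + ‖a‖₊) h := by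
    rw [hh]
    have h2 : LipschitzWith ‖a‖₊ (fun x : ℝ => a * x) := by
      simpa using lipschitzWith_smul (β := ℝ) a
    exact hg.sub h2
  obtain ⟨M, hM⟩ : ∃ M : NNReal, M = K + ‖a‖₊ := ⟨_, rfl⟩
  rw [← hM] at hhlip
  have hcomp : ∀ τ, IsCompact ((fun p => h (max p τ)) '' Icc c b) := fun τ =>
    isCompact_Icc.image (hhlip.continuous.comp (by fun_prop))
  have hne : ∀ τ, ((fun p => h (max p τ)) '' Icc c b).Nonempty := fun τ =>
    (nonempty_Icc.2 hcb).image _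
  obtain ⟨v, hv⟩ : ∃ v : ℝ → ℝ, v = fun τ => sSup ((fun p => h (max p τ)) '' Icc c b) := ⟨_, rfl⟩
  have hle : ∀ τ, ∀ p ∈ Icc c b, h (max p τ) ≤ v τ := fun τ p hp => by
    rw [hv]; exact le_csSup (hcomp τ).bddAbove ⟨p, hp, rfl⟩
  have hex : ∀ τ, ∃ p ∈ Icc c b, h (max p τ) = v τ := fun τ => by
    rw [hv]; exact (hcomp τ).sSup_mem (hne τ)
  have hvlip : LipschitzWith M v := by
    refine LipschitzWith.of_le_add_mul M fun x y => ?_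
    obtain ⟨p, hp, hpx⟩ := hex x
    have h1 := hle y p hp
    have h2 := hhlip.dist_le_mul (max p x) (max p y)
    have h3 : dist (max p x) (max p y) ≤ dist x y := by
      rw [Real.dist_eq, Real.dist_eq]
      have := abs_max_sub_max_le_max p x p y
      simpa using this
    have h4 := le_abs_self (h (max p x) - h (max p y))
    rw [← Real.dist_eq] at h4
    have h5 := mul_le_mul_of_nonneg_left h3 M.2
    simp only [NNReal.val_eq_coe] at h5
    linarith
  obtain ⟨w, hw⟩ : ∃ w : ℝ → ℝ, w = fun x => v x - h x := ⟨_, rfl⟩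
  have hwlip : LipschitzWith (M + M) w := hw ▸ hvlip.sub hhlip
  have hvh : ∀ τ ∈ Icc c b, h τ ≤ v τ := fun τ hτ => by
    have := hle τ c ⟨le_rfl, hcb⟩
    rwa [max_eq_right hτ.1] at this
  have hwac := (hwlip.lipschitzOnWith (s := uIcc c b)).absolutelyContinuousOnInterval
  have hint : ∫ x in Ioo c b, deriv w x ≤ 0 := by
    rw [← integral_Ioc_eq_integral_Ioo, ← intervalIntegral.integral_of_le hcb,
      hwac.integral_deriv_eq_sub]
    have h1 : v b = h b := by
      obtain ⟨p, hp, hpx⟩ := hex b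
      rw [max_eq_right hp.2] at hpx
      exact hpx.symm
    have h2 := hvh c ⟨le_rfl, hcb⟩
    rw [hw]
    simp only [h1]
    linarith
  obtain ⟨B, hB⟩ : ∃ B : Set ℝ, B = {τ | 0 < w τ} := ⟨_, rfl⟩
  have hBmeas : MeasurableSet B := by
    rw [hB]; exact (isOpen_lt continuous_const hwlip.continuous).measurableSet
  have hgd : IntegrableOn (deriv g) (Ioo c b) := by
    have := (hg.lipschitzOnWith (s := uIcc c b)).absolutelyContinuousOnInterval.intervalIntegrable_deriv
    exact ((intervalIntegrable_iff_integrableOn_Ioc_of_le hcb).1 this).mono_set Ioo_subset_Ioc_self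
  have hwd : IntegrableOn (deriv w) (Ioo c b) :=
    ((intervalIntegrable_iff_integrableOn_Ioc_of_le hcb).1 hwac.intervalIntegrable_deriv).mono_set
      Ioo_subset_Ioc_self
  have hpt : ∀ᵐ x ∂(volume.restrict (Ioo c b)),
      B.indicator (fun _ => a) x ≤ deriv w x + max (deriv g x) 0 := by
    filter_upwards [ae_restrict_of_ae hg.ae_differentiableAt_real,
      ae_restrict_of_ae hvlip.ae_differentiableAt_real, ae_restrict_mem measurableSet_Ioo]
      with x hgx hvx hx
    have hhx : HasDerivAt h (deriv g x - a) x := by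
      rw [hh]
      have := hgx.hasDerivAt.sub ((hasDerivAt_id x).const_mul a)
      rw [mul_one] at this
      exact this
    have hwx : deriv w x = deriv v x - (deriv g x - a) := by
      rw [hw]; exact (hvx.hasDerivAt.sub hhx).deriv
    by_cases hxB : x ∈ B
    · have hloc : IsLocalMin v x := by
        obtain ⟨p, hp, hpx⟩ := hex x
        have hlt : x < p := by
          by_contra! hcon
          rw [max_eq_right hcon] at hpx
          rw [hB, hw] at hxB
          simp only [mem_ofPred_eq] at hxB
          linarith
        rw [max_eq_left hlt.le] at hpx
        filter_upwards [gt_mem_nhds hlt] with y hy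
        have := hle y p hp
        rw [max_eq_left hy.le] at this
        linarith
      rw [indicator_of_mem hxB, hwx, hloc.deriv_eq_zero]
      linarith [le_max_left (deriv g x) 0]
    · have hloc : IsLocalMin w x := by
        filter_upwards [Ioo_mem_nhds hx.1 hx.2] with y hy
        have := hvh y (Ioo_subset_Icc_self hy)
        rw [hB] at hxB
        simp only [mem_ofPred_eq, not_lt] at hxB
        refine hxB.trans ?_
        rw [hw]
        simp only
        linarith
      rw [indicator_of_notMem hxB, hloc.deriv_eq_zero]
      linarith [le_max_right (deriv g x) 0]
  have hmax : IntegrableOn (fun x => max (deriv g x) 0) (Ioo c b) := hgd.pos_part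
  have hI := integral_mono_ae ((integrable_const a).indicator hBmeas) (hwd.add hmax) hpt
  rw [integral_indicator_const _ hBmeas] at hI
  have hadd : ∫ x in Ioo c b, (deriv w + fun x => max (deriv g x) 0) x =
      (∫ x in Ioo c b, deriv w x) + ∫ x in Ioo c b, max (deriv g x) 0 := integral_add hwd hmax
  rw [hadd, smul_eq_mul, measureReal_restrict_apply hBmeas] at hI
  have hsub : {τ ∈ Ioo c b | ∃ p ∈ Icc τ b, a * (p - τ) < g p - g τ} ⊆ B ∩ Ioo c b := by
    rintro τ ⟨hτ, p, hp, hlt⟩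
    refine ⟨?_, hτ⟩
    have := hle τ p ⟨hτ.1.le.trans hp.1, hp.2⟩
    rw [max_eq_left hp.1] at this
    rw [hB, hw]
    simp only [mem_ofPred_eq]
    rw [hh] at this ⊢
    simp only at this ⊢
    linarith
  have hvol := measureReal_mono (μ := volume) hsub
    (measure_lt_top_of_subset inter_subset_right measure_Ioo_lt_top.ne).ne
  have := mul_le_mul_of_nonneg_left hvol ha
  linarith

open MeasureTheory Set in
lemma volume_exists_slope_gt {g : ℝ → ℝ} {K : NNReal} (hg : LipschitzWith K g)
    (a : ℝ) (ha : 0 ≤ a) :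
    a * volume.real {τ ∈ Ioo (-1) 1 | ∃ p ∈ Icc (-1) 1, a * |p - τ| < |g p - g τ|} ≤
      2 * ∫ x in Ioo (-1) 1, |deriv g x| := by
  have hgd : IntegrableOn (deriv g) (Ioo (-1) 1) := by
    have := (hg.lipschitzOnWith (s := uIcc (-1) 1)).absolutelyContinuousOnInterval.intervalIntegrable_deriv
    exact ((intervalIntegrable_iff_integrableOn_Ioc_of_le (by norm_num)).1 this).mono_set
      Ioo_subset_Ioc_self
  have hrefl : ∀ u : ℝ → ℝ, ∫ x in Ioo (-1) 1, u (-x) = ∫ x in Ioo (-1) 1, u x := fun u => by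
    rw [← integral_Ioc_eq_integral_Ioo, ← intervalIntegral.integral_of_le (by norm_num),
      intervalIntegral.integral_comp_neg, neg_neg, intervalIntegral.integral_of_le (by norm_num),
      integral_Ioc_eq_integral_Ioo]
  have hg1 : LipschitzWith K (fun x => -g x) := hg.neg
  have hg2 : LipschitzWith K (fun x => g (-x)) := by
    have := hg.comp (LipschitzWith.id (α := ℝ)).neg
    rw [mul_one] at this
    exact this
  have hg3 : LipschitzWith K (fun x => -g (-x)) := hg2.neg
  have e0 := volume_exists_slope_right_gt hg (c := -1) (b := 1) (by norm_num) a ha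
  have e1 := volume_exists_slope_right_gt hg1 (c := -1) (b := 1) (by norm_num) a ha
  have e2 := volume_exists_slope_right_gt hg2 (c := -1) (b := 1) (by norm_num) a ha
  have e3 := volume_exists_slope_right_gt hg3 (c := -1) (b := 1) (by norm_num) a ha
  simp only [deriv.fun_neg, deriv_comp_neg, neg_neg] at e1 e2 e3
  rw [hrefl (fun x => max (-deriv g x) 0)] at e2
  rw [hrefl (fun x => max (deriv g x) 0)] at e3
  set A0 := {τ ∈ Ioo (-1) 1 | ∃ p ∈ Icc τ 1, a * (p - τ) < g p - g τ}
  set A1 := {τ ∈ Ioo (-1) 1 | ∃ p ∈ Icc τ 1, a * (p - τ) < -g p - -g τ}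
  set A2 := {τ ∈ Ioo (-1) 1 | ∃ p ∈ Icc τ 1, a * (p - τ) < g (-p) - g (-τ)}
  set A3 := {τ ∈ Ioo (-1) 1 | ∃ p ∈ Icc τ 1, a * (p - τ) < -g (-p) - -g (-τ)}
  have hsub : {τ ∈ Ioo (-1) 1 | ∃ p ∈ Icc (-1) 1, a * |p - τ| < |g p - g τ|} ⊆
      (A0 ∪ A1) ∪ (-A2 ∪ -A3) := by
    rintro τ ⟨hτ, p, hp, hlt⟩
    have hτ' : -τ ∈ Ioo (-1 : ℝ) 1 := ⟨by linarith [hτ.2], by linarith [hτ.1]⟩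
    rcases le_total τ p with hle | hle
    · rw [abs_of_nonneg (sub_nonneg.2 hle)] at hlt
      left
      rcases lt_abs.1 hlt with h | h
      · exact Or.inl ⟨hτ, p, ⟨hle, hp.2⟩, h⟩
      · exact Or.inr ⟨hτ, p, ⟨hle, hp.2⟩, by linarith⟩
    · rw [abs_of_nonpos (sub_nonpos.2 hle)] at hlt
      right
      rcases lt_abs.1 hlt with h | h
      · refine Or.inl ⟨hτ', -p, ⟨by linarith, by linarith [hp.1]⟩, ?_⟩
        rw [neg_neg, neg_neg]; linarith
      · refine Or.inr ⟨hτ', -p, ⟨by linarith, by linarith [hp.1]⟩, ?_⟩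
        rw [neg_neg, neg_neg]; linarith
  have hv : ∀ A : Set ℝ, volume.real (-A) = volume.real A := fun A => by
    rw [measureReal_def, measureReal_def, Measure.measure_neg]
  have hfin : ∀ A ⊆ Ioo (-1 : ℝ) 1, volume A ≠ ⊤ := fun A hA =>
    (measure_lt_top_of_subset hA measure_Ioo_lt_top.ne).ne
  have f0 : A0 ⊆ Ioo (-1) 1 := fun _ h => h.1
  have f1 : A1 ⊆ Ioo (-1) 1 := fun _ h => h.1
  have hneg : ∀ A ⊆ Ioo (-1 : ℝ) 1, -A ⊆ Ioo (-1 : ℝ) 1 := fun A hA x hx => by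
    have := hA hx
    exact ⟨by linarith [this.2], by linarith [this.1]⟩
  have f2 : -A2 ⊆ Ioo (-1) 1 := hneg _ fun _ h => h.1
  have f3 : -A3 ⊆ Ioo (-1) 1 := hneg _ fun _ h => h.1
  have hvol := measureReal_mono (μ := volume) hsub
    (hfin _ (union_subset (union_subset f0 f1) (union_subset f2 f3)))
  have u1 := measureReal_union_le (μ := volume) (A0 ∪ A1) (-A2 ∪ -A3)
  have u2 := measureReal_union_le (μ := volume) A0 A1
  have u3 := measureReal_union_le (μ := volume) (-A2) (-A3)
  rw [hv, hv] at u3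
  have hmul := mul_le_mul_of_nonneg_left (hvol.trans (u1.trans (add_le_add u2 u3))) ha
  have hP : IntegrableOn (fun x => max (deriv g x) 0) (Ioo (-1) 1) := hgd.pos_part
  have hN : IntegrableOn (fun x => max (-deriv g x) 0) (Ioo (-1) 1) := hgd.neg_part
  have habs : ∫ x in Ioo (-1) 1, |deriv g x| =
      (∫ x in Ioo (-1) 1, max (deriv g x) 0) + ∫ x in Ioo (-1) 1, max (-deriv g x) 0 := by
    rw [← integral_add hP hN]
    refine integral_congr_ae (Eventually.of_forall fun x => ?_)
    simp only
    rcases le_total 0 (deriv g x) with h | h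
    · rw [abs_of_nonneg h, max_eq_left h, max_eq_right (by linarith), add_zero]
    · rw [abs_of_nonpos h, max_eq_right h, max_eq_left (by linarith), zero_add]
  rw [habs]
  linarith

open MeasureTheory Set in
/-- If a Lipschitz function is negligible outside `[-1, 1]` but not inside, then at some point its
derivative is positive and controls all the slopes at that point. -/
lemma exists_deriv_controls_slope {g : ℝ → ℝ} {K : NNReal} (hg : LipschitzWith K g)
    (hK : 0 < (K : ℝ)) {ζ q κ ρ : ℝ} (hζ : |ζ| < 1) (hq : 0 < q) (hgζ : q ≤ |g ζ|) (hκ0 : 0 ≤ κ)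
    (hκ : κ ≤ q / 100) (hκ' : 3 * κ * K ≤ q / 100 * Real.sqrt (K * (q / 100))) (hρ1 : 1 ≤ ρ)
    (hρ : ∀ t, 1 ≤ |t| → |t| ≤ ρ → |g t| ≤ κ * |t|) :
    ∃ τ ∈ Ioo (-1 : ℝ) 1, τ ≠ ζ ∧ DifferentiableAt ℝ g τ ∧ q / 100 ≤ deriv g τ ∧
      ∀ t, |τ + t| ≤ ρ → |g (τ + t) - g τ| ≤ 11 * Real.sqrt (K * deriv g τ) * |t| := by
  by_contra! hcon
  have hg1 : |g 1| ≤ κ := by simpa using hρ 1 (by simp) (by simpa using hρ1)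
  have hgm1 : |g (-1)| ≤ κ := by simpa using hρ (-1) (by simp) (by simpa using hρ1)
  have hlip : ∀ x y, |g x - g y| ≤ K * |x - y| := fun x y => by
    simpa [Real.dist_eq] using hg.dist_le_mul x y
  obtain ⟨hζ1, hζ2⟩ := abs_lt.1 hζ
  obtain ⟨θ, hθ⟩ : ∃ θ, θ = q / 100 := ⟨_, rfl⟩
  rw [← hθ] at hκ hκ' hcon
  have hθ0 : 0 < θ := by rw [hθ]; positivity
  obtain ⟨β, hβ⟩ : ∃ β, β = θ / K := ⟨_, rfl⟩
  have hβ0 : 0 < β := by rw [hβ]; positivity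
  have hβK : β * K = θ := by rw [hβ]; field_simp
  have hβ1 : β ≤ 1 := by
    have h1 := hlip ζ 1
    have h2 : |ζ - 1| ≤ 2 := by rw [abs_le]; constructor <;> linarith
    have h3 := abs_sub_abs_le_abs_sub (g ζ) (g 1)
    have h4 := mul_le_mul_of_nonneg_left h2 hK.le
    by_contra! h5
    have := mul_lt_mul_of_pos_right h5 hK
    linarith
  have hgd : IntegrableOn (deriv g) (Ioo (-1) 1) := by
    have := (hg.lipschitzOnWith (s := uIcc (-1) 1)).absolutelyContinuousOnInterval.intervalIntegrable_deriv
    exact ((intervalIntegrable_iff_integrableOn_Ioc_of_le (by norm_num)).1 this).mono_set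
      Ioo_subset_Ioc_self
  have hdle : ∀ x, |deriv g x| ≤ K := fun x => by
    simpa using norm_deriv_le_of_lipschitz hg (x₀ := x)
  have hmaxint : IntegrableOn (fun x => max (deriv g x) 0) (Ioo (-1) 1) := hgd.pos_part
  obtain ⟨P, hP⟩ : ∃ P, P = ∫ x in Ioo (-1) 1, max (deriv g x) 0 := ⟨_, rfl⟩
  obtain ⟨I, hI⟩ : ∃ I, I = ∫ x in Ioo (-1) 1, |deriv g x| := ⟨_, rfl⟩
  have hFTC : ∀ c d, c ≤ d → ∫ x in Ioo c d, deriv g x = g d - g c := fun c d hcd => by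
    rw [← integral_Ioc_eq_integral_Ioo, ← intervalIntegral.integral_of_le hcd,
      (hg.lipschitzOnWith (s := uIcc c d)).absolutelyContinuousOnInterval.integral_deriv_eq_sub]
  have hPge : ∀ c d, -1 ≤ c → c ≤ d → d ≤ 1 → g d - g c ≤ P := fun c d h1 h2 h3 => by
    have hs : Ioo c d ⊆ Ioo (-1) 1 := Ioo_subset_Ioo h1 h3
    rw [← hFTC c d h2, hP]
    refine (integral_mono (hgd.mono_set hs) (hmaxint.mono_set hs) fun x => le_max_left _ _).trans ?_
    exact setIntegral_mono_set hmaxint (Eventually.of_forall fun x => le_max_right _ _)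
      hs.eventuallyLE
  have hPq : q - κ ≤ P := by
    rcases le_abs.1 hgζ with h | h
    · linarith [hPge (-1) ζ le_rfl hζ1.le hζ2.le, (abs_le.1 hgm1).2]
    · linarith [hPge ζ 1 hζ1.le hζ2.le le_rfl, (abs_le.1 hg1).1]
  have hIP : I ≤ 2 * P + 2 * κ := by
    have h1 : I = 2 * P - (g 1 - g (-1)) := by
      rw [hI, hP, ← hFTC (-1) 1 (by norm_num), ← integral_const_mul,
        ← integral_sub (hmaxint.const_mul 2) hgd]
      refine integral_congr_ae (Eventually.of_forall fun x => ?_)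
      simp only
      rcases le_total 0 (deriv g x) with h | h
      · rw [abs_of_nonneg h, max_eq_left h]; ring
      · rw [abs_of_nonpos h, max_eq_right h]; ring
    linarith [(abs_le.1 hgm1).2, (abs_le.1 hg1).1]
  have hI0 : 0 ≤ I := by rw [hI]; exact integral_nonneg fun x => abs_nonneg _
  obtain ⟨S, hS⟩ : ∃ S, S = Ioo (-1 + β) (1 - β) ∩ {τ | θ ≤ deriv g τ} := ⟨_, rfl⟩
  have hSmeas : MeasurableSet S := by
    rw [hS]
    exact measurableSet_Ioo.inter (measurableSet_le measurable_const (measurable_deriv g))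
  have hbad : ∀ τ ∈ S, τ ≠ ζ →
      ∃ p ∈ Icc (-1 : ℝ) 1, 10 * Real.sqrt (K * deriv g τ) * |p - τ| < |g p - g τ| := by
    intro τ hτS hτζ
    rw [hS] at hτS
    obtain ⟨hτ, hθτ⟩ := hτS
    rw [mem_ofPred_eq] at hθτ
    have hdiff : DifferentiableAt ℝ g τ :=
      differentiableAt_of_deriv_ne_zero (hθ0.trans_le hθτ).ne'
    obtain ⟨t, ht, hlt⟩ := hcon τ ⟨by linarith [hτ.1], by linarith [hτ.2]⟩ hτζ hdiff hθτ
    by_contra! hgood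
    obtain ⟨s, hs⟩ : ∃ s, s = Real.sqrt (K * deriv g τ) := ⟨_, rfl⟩
    rw [← hs] at hgood hlt
    have hs0 : 0 ≤ s := hs ▸ Real.sqrt_nonneg _
    have hsθ : 3 * κ ≤ β * s := by
      have h1 : Real.sqrt (K * θ) ≤ s := by rw [hs]; gcongr
      have h2 := mul_le_mul_of_nonneg_left h1 hθ0.le
      have h3 : 3 * κ * K ≤ β * s * K := by
        rw [show β * s * K = β * K * s by ring, hβK]; linarith
      exact le_of_mul_le_mul_right h3 hK
    have hend : ∀ b : ℝ, b ∈ Icc (-1 : ℝ) 1 → |g b| ≤ κ → 1 ≤ |τ + t| → β ≤ |t| → |b - τ| ≤ |t| →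
        |g (τ + t) - g τ| ≤ 11 * s * |t| := by
      intro b hb hgb hp htβ hbt
      have h1 := hgood b hb
      have h2 := hρ _ hp ht
      have h3 : |τ + t| ≤ 1 + |t| := by
        refine (abs_add_le _ _).trans (add_le_add ?_ le_rfl)
        rw [abs_le]; constructor <;> linarith [hτ.1, hτ.2]
      have h4 : |g (τ + t) - g τ| ≤ |g (τ + t)| + |g b| + |g b - g τ| := by
        have : g (τ + t) - g τ = (g (τ + t) - g b) + (g b - g τ) := by ring
        rw [this]
        refine (abs_add_le _ _).trans (add_le_add (abs_sub _ _) le_rfl)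
      have h5 : κ * |τ + t| ≤ κ * (1 + |t|) := mul_le_mul_of_nonneg_left h3 hκ0
      have h6 : 10 * s * |b - τ| ≤ 10 * s * |t| := by gcongr
      have h7 : κ * (2 + |t|) ≤ s * |t| := by
        have e1 : β * (2 + |t|) ≤ 3 * |t| := by nlinarith [abs_nonneg t]
        have e2 : κ * (β * (2 + |t|)) ≤ κ * (3 * |t|) := mul_le_mul_of_nonneg_left e1 hκ0
        have e3 : 3 * κ * |t| ≤ β * s * |t| := mul_le_mul_of_nonneg_right hsθ (abs_nonneg t)
        refine le_of_mul_le_mul_left ?_ hβ0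
        linarith
      linarith
    by_cases hin : τ + t ∈ Icc (-1 : ℝ) 1
    · have h1 := hgood _ hin
      rw [add_sub_cancel_left] at h1
      have : 0 ≤ s * |t| := by positivity
      linarith
    · refine absurd (lt_of_lt_of_le hlt ?_) (lt_irrefl _)
      rw [mem_Icc, not_and_or, not_le, not_le] at hin
      rcases hin with h | h
      · have ht0 : t < -β := by linarith [hτ.1]
        have htabs : |t| = -t := abs_of_neg (by linarith)
        refine hend (-1) (by simp) hgm1 ?_ (by linarith) ?_
        · rw [abs_of_neg (by linarith)]; linarith
        · rw [htabs, abs_of_neg (by linarith [hτ.1])]; linarith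
      · have ht0 : β < t := by linarith [hτ.2]
        have htabs : |t| = t := abs_of_pos (by linarith)
        refine hend 1 (by simp) hg1 ?_ (by linarith) ?_
        · rw [abs_of_pos (by linarith)]; linarith
        · rw [htabs, abs_of_pos (by linarith [hτ.2])]; linarith
  obtain ⟨f, hf⟩ : ∃ f, f = S.indicator (deriv g) := ⟨_, rfl⟩
  have hf0 : ∀ x, 0 ≤ f x := fun x => by
    rw [hf]
    refine indicator_nonneg (fun y hy => ?_) x
    rw [hS] at hy
    exact hθ0.le.trans hy.2
  have hfint : IntegrableOn f (Ioo (-1) 1) := by rw [hf]; exact hgd.indicator hSmeas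
  have hflevel : ∀ b, 0 < b → (volume.restrict (Ioo (-1) 1)).real {x | b < f x} ≤
      (Ioc (0 : ℝ) K).indicator (fun b => I / (5 * Real.sqrt K) * b ^ (-(1 / 2) : ℝ)) b := by
    intro b hb
    have hfS : ∀ x, b < f x → x ∈ S ∧ b < deriv g x := fun x hx => by
      rw [hf] at hx
      by_cases hxS : x ∈ S
      · rw [indicator_of_mem hxS] at hx
        exact ⟨hxS, hx⟩
      · rw [indicator_of_notMem hxS] at hx
        linarith
    by_cases hbK : b ≤ K
    · rw [indicator_of_mem (mem_Ioc.2 ⟨hb, hbK⟩)]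
      obtain ⟨a, ha⟩ : ∃ a, a = 10 * Real.sqrt (K * b) := ⟨_, rfl⟩
      have ha0 : 0 < a := by rw [ha]; positivity
      have hw := volume_exists_slope_gt hg a ha0.le
      set A := {τ ∈ Ioo (-1) 1 | ∃ p ∈ Icc (-1) 1, a * |p - τ| < |g p - g τ|}
      have hAsub : A ⊆ Ioo (-1) 1 := fun _ h => h.1
      have hAfin : volume A ≠ ⊤ :=
        (measure_lt_top_of_subset hAsub measure_Ioo_lt_top.ne).ne
      have hsub : {x | b < f x} ⊆ A ∪ {ζ} := by
        intro x hx
        obtain ⟨hxS, hbx⟩ := hfS x hx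
        by_cases hxζ : x = ζ
        · exact Or.inr hxζ
        left
        obtain ⟨p, hp, hlt⟩ := hbad x hxS hxζ
        rw [hS] at hxS
        refine ⟨⟨by linarith [hxS.1.1], by linarith [hxS.1.2]⟩, p, hp, lt_of_le_of_lt ?_ hlt⟩
        rw [ha]
        gcongr
      have hvol : (volume.restrict (Ioo (-1) 1)).real {x | b < f x} ≤ volume.real A := by
        calc _ ≤ volume.real {x | b < f x} := by
              refine ENNReal.toReal_mono ?_ (Measure.restrict_apply_le _ _)
              exact (measure_lt_top_of_subset hsub
                (measure_union_lt_top hAfin.lt_top (by simp)).ne).ne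
          _ ≤ volume.real (A ∪ {ζ}) := measureReal_mono hsub
                (measure_union_lt_top hAfin.lt_top (by simp)).ne
          _ ≤ volume.real A + volume.real {ζ} := measureReal_union_le _ _
          _ = volume.real A := by simp [measureReal_def]
      refine hvol.trans ?_
      rw [← hI] at hw
      have hsq : Real.sqrt (K * b) = Real.sqrt K * Real.sqrt b := Real.sqrt_mul hK.le b
      have hrp : b ^ (-(1 / 2) : ℝ) = (Real.sqrt b)⁻¹ := by
        rw [Real.rpow_neg hb.le, Real.sqrt_eq_rpow]
      have hKs : 0 < Real.sqrt K := Real.sqrt_pos.2 hK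
      have hbs : 0 < Real.sqrt b := Real.sqrt_pos.2 hb
      have : I / (5 * Real.sqrt K) * b ^ (-(1 / 2) : ℝ) = 2 * I / a := by
        rw [hrp, ha, hsq]; field_simp; ring
      rw [this, le_div_iff₀ ha0]
      linarith
    · rw [indicator_of_notMem (fun h => hbK h.2)]
      have : {x | b < f x} = ∅ := by
        rw [eq_empty_iff_forall_notMem]
        intro x hx
        have := (hfS x hx).2
        exact hbK (this.le.trans ((le_abs_self _).trans (hdle x)))
      rw [this]; simp
  have hlayer := hfint.integral_eq_integral_meas_lt (Eventually.of_forall hf0)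
  have hrint : IntervalIntegrable (fun b : ℝ => b ^ (-(1 / 2) : ℝ)) volume 0 K :=
    intervalIntegral.intervalIntegrable_rpow' (by norm_num)
  have hfle : ∫ x in Ioo (-1) 1, f x ≤ 2 * I / 5 := by
    rw [hlayer]
    have hint : IntegrableOn ((Ioc (0 : ℝ) K).indicator
        (fun b => I / (5 * Real.sqrt K) * b ^ (-(1 / 2) : ℝ))) (Ioi 0) := by
      refine (integrable_indicator_iff measurableSet_Ioc).2 (Integrable.mono_measure ?_
        (Measure.restrict_mono_measure Measure.restrict_le_self _))
      exact ((intervalIntegrable_iff_integrableOn_Ioc_of_le hK.le).1 hrint).const_mul _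
    refine (integral_mono_of_nonneg (Eventually.of_forall fun b => measureReal_nonneg) hint
      ((ae_restrict_mem measurableSet_Ioi).mono hflevel)).trans ?_
    rw [setIntegral_indicator measurableSet_Ioc, inter_eq_right.2 (fun x hx => hx.1),
      ← intervalIntegral.integral_of_le hK.le, intervalIntegral.integral_const_mul,
      integral_rpow (Or.inl (by norm_num))]
    have h1 : (-(1 / 2) + 1 : ℝ) = 1 / 2 := by norm_num
    rw [h1, ← Real.sqrt_eq_rpow, ← Real.sqrt_eq_rpow, Real.sqrt_zero]
    have hKs : 0 < Real.sqrt K := Real.sqrt_pos.2 hK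
    field_simp
    norm_num
  obtain ⟨E, hE⟩ : ∃ E : Set ℝ, E = Icc (-1) (-1 + β) ∪ Icc (1 - β) 1 := ⟨_, rfl⟩
  have hEmeas : MeasurableSet E := by rw [hE]; exact measurableSet_Icc.union measurableSet_Icc
  have hEvol : (volume.restrict (Ioo (-1) 1)).real E ≤ 2 * β := by
    have h1 : volume.real E ≤ 2 * β := by
      rw [hE]
      refine (measureReal_union_le _ _).trans ?_
      rw [Real.volume_real_Icc_of_le (by linarith), Real.volume_real_Icc_of_le (by linarith)]
      linarith
    refine le_trans (ENNReal.toReal_mono ?_ (Measure.restrict_apply_le _ _)) h1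
    rw [hE]
    exact (measure_union_lt_top measure_Icc_lt_top measure_Icc_lt_top).ne
  have hPle : P ≤ 2 * I / 5 + 2 * θ + 2 * θ := by
    have hpt : ∀ x ∈ Ioo (-1 : ℝ) 1,
        max (deriv g x) 0 ≤ f x + (θ + E.indicator (fun _ => (K : ℝ)) x) := by
      intro x hx
      have hE0 : 0 ≤ E.indicator (fun _ => (K : ℝ)) x := indicator_nonneg (fun _ _ => hK.le) x
      refine max_le ?_ (by linarith [hf0 x])
      by_cases hxE : x ∈ E
      · rw [indicator_of_mem hxE]
        linarith [hf0 x, (le_abs_self _).trans (hdle x)]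
      rcases lt_or_ge (deriv g x) θ with h | h
      · linarith [hf0 x]
      · have hxS : x ∈ S := by
          rw [hE, mem_union, not_or, mem_Icc, mem_Icc] at hxE
          rw [hS]
          refine ⟨⟨?_, ?_⟩, h⟩
          · by_contra! h2; exact hxE.1 ⟨hx.1.le, h2⟩
          · by_contra! h2; exact hxE.2 ⟨h2, hx.2.le⟩
        rw [hf, indicator_of_mem hxS]
        linarith
    have hEint : Integrable (E.indicator fun _ => (K : ℝ)) (volume.restrict (Ioo (-1) 1)) :=
      (integrable_const _).indicator hEmeas
    have hcint : Integrable (fun _ : ℝ => θ) (volume.restrict (Ioo (-1) 1)) := integrable_const _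
    have hm := setIntegral_mono_on hmaxint (hfint.add (hcint.add hEint)) measurableSet_Ioo hpt
    have e1 : ∫ x in Ioo (-1 : ℝ) 1, (f + ((fun _ => θ) + E.indicator fun _ => (K : ℝ)) : ℝ → ℝ) x =
        (∫ x in Ioo (-1) 1, f x) + ((∫ x in Ioo (-1 : ℝ) 1, θ) +
          ∫ x in Ioo (-1) 1, E.indicator (fun _ => (K : ℝ)) x) := by
      rw [integral_add' hfint (hcint.add hEint), integral_add' hcint hEint]
    rw [e1, ← hP, integral_indicator_const _ hEmeas, setIntegral_const,
      Real.volume_real_Ioo_of_le (by norm_num), smul_eq_mul, smul_eq_mul] at hm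
    have e2 := mul_le_mul_of_nonneg_right hEvol hK.le
    linarith
  linarith

lemma hasDirDeriv_iff_hasDerivAt {H : Type*} [NormedAddCommGroup H] [NormedSpace ℝ H]
    {f : H → ℝ} {x e : H} {L : ℝ} :
    HasDirDeriv f x e L ↔ HasDerivAt (fun t : ℝ => f (x + t • e)) L 0 := by
  rw [HasDirDeriv, hasDerivAt_iff_tendsto_slope]
  refine tendsto_congr fun t => ?_
  simp [slope_def_field]

lemma HasDirDeriv.smul {H : Type*} [NormedAddCommGroup H] [NormedSpace ℝ H]
    {f : H → ℝ} {x e : H} {L : ℝ} (h : HasDirDeriv f x e L) (k : ℝ) :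
    HasDirDeriv f x (k • e) (k * L) := by
  rw [hasDirDeriv_iff_hasDerivAt] at h ⊢
  have h1 : HasDerivAt (fun t : ℝ => t * k) k 0 := by
    simpa using (hasDerivAt_id (0 : ℝ)).mul_const k
  have h2 : HasDerivAt (fun t : ℝ => f (x + t • e)) L (0 * k) := by rwa [zero_mul]
  have h3 := h2.comp (0 : ℝ) h1
  rw [mul_comm] at h3
  refine h3.congr_of_eventuallyEq (Eventually.of_forall fun t => ?_)
  simp [smul_smul]

/-- A piecewise linear curve through three points, constant outside `[-1, 1]`. -/
lemma exists_polygonal_curve {H : Type*} [NormedAddCommGroup H] [NormedSpace ℝ H]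
    {ζ m : ℝ} (hζ : |ζ| ≤ 1 / 2) {a₁ a₂ a₃ : H} (h₁ : ‖a₁ - a₃‖ ≤ m) (h₂ : ‖a₂ - a₃‖ ≤ m)
    (e : H) :
    ∃ c : ℝ → H, (∀ t t', ‖c t - c t'‖ ≤ 4 * m * |t - t'|) ∧ (∀ t ≤ -1, c t = a₁) ∧
      (∀ t, 1 ≤ t → c t = a₂) ∧ c ζ = a₃ ∧
      (∀ τ ∈ Set.Ioo (-1 : ℝ) 1, τ • e + c τ ∈
        segment ℝ (-e + a₁) (ζ • e + a₃) ∪ segment ℝ (ζ • e + a₃) (e + a₂)) ∧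
      ∀ τ ∈ Set.Ioo (-1 : ℝ) 1, τ ≠ ζ → ∃ b : H,
        (b = (1 + ζ)⁻¹ • (a₃ - a₁) ∨ b = (1 - ζ)⁻¹ • (a₂ - a₃)) ∧
        ∀ᶠ t in nhds τ, c t = c τ + (t - τ) • b := by
  obtain ⟨hζ1, hζ2⟩ := abs_le.1 hζ
  have hp : 0 < 1 + ζ := by linarith
  have hn : 0 < 1 - ζ := by linarith
  have hclamp : ∀ x y : ℝ, |max 0 (min 1 x) - max 0 (min 1 y)| ≤ |x - y| := fun x y =>
    calc |max 0 (min 1 x) - max 0 (min 1 y)| ≤ |min 1 x - min 1 y| := by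
          simpa [max_comm] using abs_max_sub_max_le_max (min 1 x) 0 (min 1 y) 0
      _ ≤ |x - y| := by
          have := abs_min_sub_min_le_max 1 x 1 y
          simpa using this
  set l : ℝ → ℝ := fun t => max 0 (min 1 ((ζ - t) / (1 + ζ))) with hl
  set r : ℝ → ℝ := fun t => max 0 (min 1 ((t - ζ) / (1 - ζ))) with hr
  have hl_lip : ∀ t t', |l t - l t'| ≤ 2 * |t - t'| := fun t t' => by
    refine (hclamp _ _).trans ?_
    rw [← sub_div, sub_sub_sub_cancel_left, abs_div, abs_of_pos hp, div_le_iff₀ hp, abs_sub_comm]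
    nlinarith [abs_nonneg (t - t')]
  have hr_lip : ∀ t t', |r t - r t'| ≤ 2 * |t - t'| := fun t t' => by
    refine (hclamp _ _).trans ?_
    rw [← sub_div, sub_sub_sub_cancel_right, abs_div, abs_of_pos hn, div_le_iff₀ hn]
    nlinarith [abs_nonneg (t - t')]
  have hl0 : ∀ t, ζ ≤ t → l t = 0 := fun t ht =>
    max_eq_left ((min_le_right _ _).trans (div_nonpos_of_nonpos_of_nonneg (by linarith) hp.le))
  have hr0 : ∀ t, t ≤ ζ → r t = 0 := fun t ht =>
    max_eq_left ((min_le_right _ _).trans (div_nonpos_of_nonpos_of_nonneg (by linarith) hn.le))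
  have hl1 : ∀ t, t ≤ -1 → l t = 1 := fun t ht => by
    simp only [hl]
    rw [min_eq_left (by rw [le_div_iff₀ hp]; linarith), max_eq_right zero_le_one]
  have hr1 : ∀ t, 1 ≤ t → r t = 1 := fun t ht => by
    simp only [hr]
    rw [min_eq_left (by rw [le_div_iff₀ hn]; linarith), max_eq_right zero_le_one]
  have hl' : ∀ t, -1 ≤ t → t ≤ ζ → l t = (ζ - t) / (1 + ζ) := fun t h h' => by
    simp only [hl]
    rw [min_eq_right (by rw [div_le_iff₀ hp]; linarith),
      max_eq_right (div_nonneg (by linarith) hp.le)]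
  have hr' : ∀ t, ζ ≤ t → t ≤ 1 → r t = (t - ζ) / (1 - ζ) := fun t h h' => by
    simp only [hr]
    rw [min_eq_right (by rw [div_le_iff₀ hn]; linarith),
      max_eq_right (div_nonneg (by linarith) hn.le)]
  refine ⟨fun t => a₃ + l t • (a₁ - a₃) + r t • (a₂ - a₃), fun t t' => ?_, fun t ht => ?_,
    fun t ht => ?_, ?_, fun τ hτ => ?_, fun τ hτ hne => ?_⟩
  · have heq : a₃ + l t • (a₁ - a₃) + r t • (a₂ - a₃) -
        (a₃ + l t' • (a₁ - a₃) + r t' • (a₂ - a₃)) =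
        (l t - l t') • (a₁ - a₃) + (r t - r t') • (a₂ - a₃) := by
      simp only [sub_smul]; abel
    simp only
    rw [heq]
    refine (norm_add_le _ _).trans ?_
    rw [norm_smul, norm_smul, Real.norm_eq_abs, Real.norm_eq_abs]
    have e1 := mul_le_mul (hl_lip t t') h₁ (norm_nonneg _) (by positivity)
    have e2 := mul_le_mul (hr_lip t t') h₂ (norm_nonneg _) (by positivity)
    linarith
  · simp [hl1 t ht, hr0 t (by linarith)]
  · simp [hr1 t ht, hl0 t (by linarith)]
  · simp [hl0 ζ le_rfl, hr0 ζ le_rfl]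
  · rcases le_total τ ζ with h | h
    · left
      rw [segment_symm, segment_eq_image]
      refine ⟨(ζ - τ) / (1 + ζ), ⟨div_nonneg (by linarith) hp.le, ?_⟩, ?_⟩
      · rw [div_le_one hp]; linarith [hτ.1]
      · simp only [hr0 τ h, hl' τ hτ.1.le h]
        match_scalars <;> field_simp <;> ring
    · right
      rw [segment_eq_image]
      refine ⟨(τ - ζ) / (1 - ζ), ⟨div_nonneg (by linarith) hn.le, ?_⟩, ?_⟩
      · rw [div_le_one hn]; linarith [hτ.2]
      · simp only [hl0 τ h, hr' τ h hτ.2.le]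
        match_scalars <;> field_simp <;> ring
  · rcases lt_or_gt_of_ne hne with h | h
    · refine ⟨_, Or.inl rfl, ?_⟩
      filter_upwards [Ioo_mem_nhds hτ.1 h] with t ht
      simp only [hr0 τ h.le, hr0 t ht.2.le, hl' τ hτ.1.le h.le, hl' t ht.1.le ht.2.le]
      match_scalars <;> field_simp <;> ring
    · refine ⟨_, Or.inr rfl, ?_⟩
      filter_upwards [Ioo_mem_nhds h hτ.2] with t ht
      simp only [hl0 τ h.le, hl0 t ht.1.le, hr' τ h.le hτ.2.le, hr' t ht.1.le ht.2.le]
      match_scalars <;> field_simp <;> ring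

lemma norm_add_smul_add_bounds {H : Type*} [NormedAddCommGroup H] [InnerProductSpace ℝ H]
    {e v d : H} {k N : ℝ} (he : ‖e‖ = 1) (hv : inner ℝ e v = 0) (hN : 0 < N) (hvN : ‖v‖ ≤ 1 / N)
    (hk : |k| ≤ 2) (hd : ‖d‖ ≤ 1 / N ^ 2) (hN2 : 2 ≤ N) :
    0 < ‖e + (k • v + d)‖ ∧ ‖e + (k • v + d)‖ ≤ 1 + 3 / N ^ 2 := by
  have hsq : ‖e + k • v‖ ^ 2 = 1 + (|k| * ‖v‖) ^ 2 := by
    rw [norm_add_sq_real, inner_smul_right, hv, norm_smul, he, Real.norm_eq_abs]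
    ring
  have hkv : |k| * ‖v‖ ≤ 2 * (1 / N) := by gcongr
  have hN' : 1 / N ^ 2 ≤ 1 / 4 := by
    apply one_div_le_one_div_of_le <;> nlinarith
  have h1 : 1 ≤ ‖e + k • v‖ := by
    have := norm_nonneg (e + k • v)
    nlinarith [sq_nonneg (|k| * ‖v‖)]
  have h2 : ‖e + k • v‖ ≤ 1 + 2 / N ^ 2 := by
    have e0 : (|k| * ‖v‖) ^ 2 ≤ (2 * (1 / N)) ^ 2 := by gcongr
    have e1 : (2 * (1 / N)) ^ 2 = 4 / N ^ 2 := by field_simp; norm_num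
    have e2 : 0 < 2 / N ^ 2 := by positivity
    have e3 : 4 / N ^ 2 = 2 * (2 / N ^ 2) := by ring
    refine le_of_sq_le_sq ?_ (by positivity)
    nlinarith
  have h3 := norm_sub_norm_le (e + k • v) (-d)
  have h4 := norm_add_le (e + k • v) d
  rw [norm_neg, sub_neg_eq_add] at h3
  rw [← add_assoc]
  have h5 : 3 / N ^ 2 = 2 / N ^ 2 + 1 / N ^ 2 := by ring
  constructor <;> linarith

set_option maxHeartbeats 800000 in
/-- Perturbation lemma at unit scale: if `f` fails to be approximated by its linear part at `z`,
then on any polygonal path close to `[-e, z] ∪ [z, e]` there is a point with a substantially larger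
directional derivative, with control of the increments in the direction `e`. -/
lemma exists_larger_dirDeriv {H : Type*} [NormedAddCommGroup H] [InnerProductSpace ℝ H]
    {f : H → ℝ} {L : ℝ} (hL : 0 < L) (hf : ∀ y z, |f y - f z| ≤ L * ‖y - z‖) (hf0 : f 0 = 0)
    {e : H} (he : ‖e‖ = 1) {fd : ℝ} (hfd0 : 0 ≤ fd) (hfdL : fd ≤ L)
    {N ε η σ R θ : ℝ} (hε : 0 < ε) (hN : 100 ≤ N) (hNL : 1000000 * L ≤ ε * N)
    (hθ : θ = ε / (200 * N)) (hη0 : 0 ≤ η) (hη : 4 * η ≤ 1 / N ^ 2) (hLη : L * η ≤ ε / (2 * N))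
    (hσ0 : 0 ≤ σ) (hκ : L * η + σ ≤ θ)
    (hκ' : 3 * (L * η + σ) * (3 * L) ≤ θ * Real.sqrt (3 * L * θ))
    (hσ : σ ≤ Real.sqrt (L * θ) / 2) (hR : 0 ≤ R) (hRL : 4 * L ≤ R * Real.sqrt (L * θ))
    (happ : ∀ t : ℝ, |t| ≤ R + 1 → |f (t • e) - fd * t| ≤ σ * |t|)
    {z : H} (hz : ‖z‖ ≤ 1 / N) (hfz : ε / N ≤ |f z - fd * inner ℝ e z|)
    {p₁ p₂ p₃ : H} (hp₁ : ‖p₁ - -e‖ ≤ η) (hp₂ : ‖p₂ - e‖ ≤ η) (hp₃ : ‖p₃ - z‖ ≤ η) :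
    ∃ x' ∈ segment ℝ p₁ p₃ ∪ segment ℝ p₃ p₂, ∃ e' : H, ‖e'‖ = 1 ∧ ∃ fd' : ℝ,
      HasDirDeriv f x' e' fd' ∧ fd + 4 / 5 * θ ≤ fd' ∧
      ∀ t : ℝ, |(f (x' + t • e) - f x') - f (t • e)| ≤ 25 * Real.sqrt ((fd' - fd) * L) * |t| := by
  have hN0 : 0 < N := by linarith
  have hθ0 : 0 < θ := by rw [hθ]; positivity
  have hNN : 1 / N ^ 2 ≤ 1 / N := by
    apply one_div_le_one_div_of_le hN0; nlinarith
  have hN1 : 1 / N ≤ 1 / 100 := one_div_le_one_div_of_le (by norm_num) hN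
  obtain ⟨S, hS⟩ : ∃ S, S = Real.sqrt (L * θ) := ⟨_, rfl⟩
  have hS0 : 0 < S := by rw [hS]; positivity
  have hSsq : S ^ 2 = L * θ := by rw [hS, Real.sq_sqrt (by positivity)]
  obtain ⟨ζ, hζ⟩ : ∃ ζ, ζ = inner ℝ e z := ⟨_, rfl⟩
  have hζN : |ζ| ≤ 1 / N := by
    rw [hζ]
    have := abs_real_inner_le_norm e z
    rw [he, one_mul] at this
    linarith
  obtain ⟨v, hv⟩ : ∃ v, v = z - ζ • e := ⟨_, rfl⟩
  have hev : inner ℝ e v = 0 := by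
    rw [hv, inner_sub_right, inner_smul_right, real_inner_self_eq_norm_sq, he, hζ]
    ring
  have hvN : ‖v‖ ≤ 1 / N := by
    have h1 : z = v + ζ • e := by rw [hv]; abel
    have h2 : ‖z‖ ^ 2 = ‖v‖ ^ 2 + ‖ζ • e‖ ^ 2 := by
      rw [h1, norm_add_sq_real, inner_smul_right, real_inner_comm, hev]; ring
    refine le_trans ?_ hz
    refine le_of_sq_le_sq ?_ (norm_nonneg _)
    nlinarith [sq_nonneg ‖ζ • e‖]
  obtain ⟨a₁, ha₁⟩ : ∃ a, a = p₁ - -e := ⟨_, rfl⟩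
  obtain ⟨a₂, ha₂⟩ : ∃ a, a = p₂ - e := ⟨_, rfl⟩
  obtain ⟨d₃, hd₃⟩ : ∃ d, d = p₃ - z := ⟨_, rfl⟩
  rw [← ha₁] at hp₁
  rw [← ha₂] at hp₂
  rw [← hd₃] at hp₃
  have hbd : ∀ a : H, ‖a‖ ≤ η → ‖a - (v + d₃)‖ ≤ 2 / N := fun a ha => by
    have h1 := norm_sub_le a (v + d₃)
    have h2 := norm_add_le v d₃
    have h3 : 2 / N = 1 / N + 1 / N := by ring
    linarith
  obtain ⟨c, hclip, hcl, hcr, hcζ, hseg, hder⟩ :=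
    exists_polygonal_curve (ζ := ζ) (by linarith) (hbd a₁ hp₁) (hbd a₂ hp₂) e
  have hmN : 4 * (2 / N) = 8 / N := by ring
  rw [hmN] at hclip
  have h8N : 8 / N ≤ 1 := by rw [div_le_one hN0]; linarith
  have hpp : -e + a₁ = p₁ ∧ ζ • e + (v + d₃) = p₃ ∧ e + a₂ = p₂ := by
    refine ⟨by rw [ha₁]; abel, by rw [hv, hd₃]; abel, by rw [ha₂]; abel⟩
  rw [hpp.1, hpp.2.1, hpp.2.2] at hseg
  obtain ⟨g, hg⟩ : ∃ g : ℝ → ℝ, g = fun t => f (t • e + c t) - fd * t := ⟨_, rfl⟩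
  have hglip : LipschitzWith (Real.toNNReal (3 * L)) g := by
    refine LipschitzWith.of_dist_le_mul fun s t => ?_
    rw [Real.coe_toNNReal _ (by positivity), Real.dist_eq, Real.dist_eq, hg]
    have h1 := hf (s • e + c s) (t • e + c t)
    have h2 : ‖s • e + c s - (t • e + c t)‖ ≤ |s - t| + 1 * |s - t| := by
      have : s • e + c s - (t • e + c t) = (s - t) • e + (c s - c t) := by
        rw [sub_smul]; abel
      rw [this]
      refine (norm_add_le _ _).trans (add_le_add ?_ ((hclip s t).trans (by gcongr)))
      rw [norm_smul, he, Real.norm_eq_abs, mul_one]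
    have h3 : |fd * (s - t)| ≤ L * |s - t| := by
      rw [abs_mul, abs_of_nonneg hfd0]; gcongr
    have h4 := mul_le_mul_of_nonneg_left h2 hL.le
    calc |f (s • e + c s) - fd * s - (f (t • e + c t) - fd * t)|
        = |(f (s • e + c s) - f (t • e + c t)) - fd * (s - t)| := by ring_nf
      _ ≤ |f (s • e + c s) - f (t • e + c t)| + |fd * (s - t)| := abs_sub _ _
      _ ≤ 3 * L * |s - t| := by linarith
  have hgζ : ε / (2 * N) ≤ |g ζ| := by
    have h1 : g ζ = f p₃ - fd * ζ := by simp only [hg]; rw [hcζ, hpp.2.1]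
    have h2 := hf p₃ z
    rw [← hd₃] at h2
    have h3 := mul_le_mul_of_nonneg_left hp₃ hL.le
    rw [← hζ] at hfz
    have h4 : |f z - fd * ζ| ≤ |f p₃ - fd * ζ| + |f p₃ - f z| := by
      have : f z - fd * ζ = (f p₃ - fd * ζ) - (f p₃ - f z) := by ring
      rw [this]; exact abs_sub _ _
    have h5 : ε / N = ε / (2 * N) + ε / (2 * N) := by field_simp; norm_num
    rw [h1]
    linarith
  have hθq : θ = ε / (2 * N) / 100 := by rw [hθ]; field_simp; norm_num
  have hgout : ∀ t, 1 ≤ |t| → |t| ≤ R + 1 → |g t| ≤ (L * η + σ) * |t| := by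
    intro t ht ht'
    have h1 : ‖c t‖ ≤ η := by
      rcases le_abs.1 ht with h | h
      · rw [hcr t h]; exact hp₂
      · rw [hcl t (by linarith)]; exact hp₁
    have h2 := hf (t • e + c t) (t • e)
    rw [add_sub_cancel_left] at h2
    have h3 := happ t ht'
    have h4 : |g t| ≤ |f (t • e + c t) - f (t • e)| + |f (t • e) - fd * t| := by
      have : g t = (f (t • e + c t) - f (t • e)) + (f (t • e) - fd * t) := by rw [hg]; ring
      rw [this]; exact abs_add_le _ _
    have h5 := mul_le_mul_of_nonneg_left h1 hL.le
    have h6 : L * η * 1 ≤ L * η * |t| := by gcongr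
    linarith
  have hK : (Real.toNNReal (3 * L) : ℝ) = 3 * L := Real.coe_toNNReal _ (by positivity)
  obtain ⟨τ, hτ, hτζ, hdiff, hθτ, hslope⟩ := exists_deriv_controls_slope hglip
    (by rw [hK]; positivity) (ζ := ζ) (q := ε / (2 * N)) (κ := L * η + σ) (ρ := R + 1)
    (by linarith) (by positivity) hgζ (by positivity) (by rw [← hθq]; exact hκ)
    (by rw [hK, ← hθq]; exact hκ') (by linarith) hgout
  rw [← hθq] at hθτ
  rw [hK] at hslope
  obtain ⟨G, hG⟩ : ∃ G, G = deriv g τ := ⟨_, rfl⟩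
  rw [← hG] at hθτ hslope
  obtain ⟨b, hb, hcloc⟩ := hder τ hτ hτζ
  obtain ⟨W, hW⟩ : ∃ W, W = ‖e + b‖ := ⟨_, rfl⟩
  have hζ' := abs_le.1 hζN
  have hWb : 0 < W ∧ W ≤ 1 + 3 / N ^ 2 := by
    have key : ∀ k : ℝ, |k| ≤ 2 → ∀ a : H, ‖a‖ ≤ η → b = k • (v + d₃ - a) →
        0 < W ∧ W ≤ 1 + 3 / N ^ 2 := by
      intro k hk a ha hba
      have h1 : b = k • v + k • (d₃ - a) := by rw [hba]; module
      rw [hW, h1]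
      refine norm_add_smul_add_bounds he hev hN0 hvN hk ?_ (by linarith)
      rw [norm_smul, Real.norm_eq_abs]
      have h2 := norm_sub_le d₃ a
      have h3 := mul_le_mul hk (h2.trans (add_le_add hp₃ ha)) (norm_nonneg _) (by norm_num)
      linarith
    have hinv : ∀ y : ℝ, 1 / 2 ≤ y → |y⁻¹| ≤ 2 := fun y hy => by
      rw [abs_of_pos (by positivity), inv_le_comm₀ (by linarith) (by norm_num)]
      linarith
    rcases hb with h | h
    · exact key _ (hinv (1 + ζ) (by linarith [hζ'.1])) a₁ hp₁ h
    · refine key (-(1 - ζ)⁻¹) ?_ a₂ hp₂ (by rw [h]; module)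
      rw [abs_neg]
      exact hinv (1 - ζ) (by linarith [hζ'.2])
  obtain ⟨hW0, hW1⟩ := hWb
  have hdir : HasDirDeriv f (τ • e + c τ) (e + b) (fd + G) := by
    rw [hasDirDeriv_iff_hasDerivAt]
    have h1 : HasDerivAt g G (τ + 0) := by rw [add_zero, hG]; exact hdiff.hasDerivAt
    have h2 := (h1.comp_const_add τ 0).add (((hasDerivAt_id (0 : ℝ)).const_add τ).const_mul fd)
    rw [mul_one, add_comm G fd] at h2
    refine h2.congr_of_eventuallyEq ?_
    have h3 : Tendsto (fun t : ℝ => τ + t) (nhds 0) (nhds τ) := by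
      have : Continuous fun t : ℝ => τ + t := by fun_prop
      simpa using this.tendsto 0
    filter_upwards [h3.eventually hcloc] with t ht
    simp only [hg, Pi.add_apply, id]
    rw [ht, add_sub_cancel_left, sub_add_cancel]
    congr 1
    module
  have h3N : 3 / N ^ 2 ≤ 1 / 10 := by
    have : 3 / N ^ 2 = 3 * (1 / N ^ 2) := by ring
    linarith
  have hL3N : L * (3 / N ^ 2) ≤ θ / 10 := by
    rw [hθ, mul_div_assoc', div_div, div_le_div_iff₀ (by positivity) (by positivity)]
    nlinarith
  have hSL : L * (8 / N) ≤ S / 2 := by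
    refine le_of_sq_le_sq ?_ (by positivity)
    rw [div_pow, hSsq, hθ]
    have e1 : (L * (8 / N)) ^ 2 = L * (64 * L / N ^ 2) := by ring
    have e2 : L * (ε / (200 * N)) / 2 ^ 2 = L * (ε / (800 * N)) := by field_simp; norm_num
    rw [e1, e2]
    refine mul_le_mul_of_nonneg_left ?_ hL.le
    rw [div_le_div_iff₀ (by positivity) (by positivity)]
    nlinarith
  have hG0 : 0 < G := hθ0.trans_le hθτ
  obtain ⟨fd', hfd'⟩ : ∃ fd', fd' = W⁻¹ * (fd + G) := ⟨_, rfl⟩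
  have hgain : fd + 4 / 5 * G ≤ fd' := by
    rw [hfd', inv_mul_eq_div, le_div_iff₀ hW0]
    have e1 : (fd + 4 / 5 * G) * W ≤ (fd + 4 / 5 * G) * (1 + 3 / N ^ 2) := by gcongr
    have e2 : fd * (3 / N ^ 2) ≤ L * (3 / N ^ 2) := by gcongr
    have e3 : 4 / 5 * G * (3 / N ^ 2) ≤ 4 / 5 * G * (1 / 10) := by gcongr
    linarith
  refine ⟨τ • e + c τ, hseg τ hτ, W⁻¹ • (e + b), ?_, fd', ?_, by linarith, fun t => ?_⟩
  · rw [norm_smul, ← hW, norm_inv, Real.norm_of_nonneg hW0.le, inv_mul_cancel₀ hW0.ne']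
  · rw [hfd']; exact hdir.smul _
  obtain ⟨T, hT⟩ : ∃ T, T = Real.sqrt (L * G) := ⟨_, rfl⟩
  have hST : S ≤ T := by rw [hS, hT]; gcongr
  have hσT : σ ≤ T / 2 := by rw [← hS] at hσ; linarith only [hσ, hST]
  have hLT : L * (8 / N) ≤ T / 2 := by linarith only [hSL, hST]
  have hT3 : Real.sqrt (3 * L * G) ≤ 1.7321 * T := by
    rw [mul_assoc, Real.sqrt_mul (by norm_num), ← hT]
    exact mul_le_mul_of_nonneg_right (Real.sqrt_le_iff.2 ⟨by norm_num, by norm_num⟩)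
      (hS0.le.trans hST)
  have hgainT : 0.894 * T ≤ Real.sqrt ((fd' - fd) * L) := by
    apply Real.le_sqrt_of_sq_le
    rw [mul_pow, hT, Real.sq_sqrt (by positivity)]
    have : 4 / 5 * G * L ≤ (fd' - fd) * L := by gcongr; linarith
    nlinarith [mul_pos hG0 hL]
  have hgoal : |(f (τ • e + c τ + t • e) - f (τ • e + c τ)) - f (t • e)| ≤ 22.35 * T * |t| := by
    rcases le_or_gt |t| R with ht | ht
    · have h1 : |τ + t| ≤ R + 1 := by
        refine (abs_add_le _ _).trans ?_
        have : |τ| ≤ 1 := abs_le.2 ⟨hτ.1.le, hτ.2.le⟩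
        linarith
      have h2 := hslope t h1
      have h3 := happ t (by linarith)
      have h4 := hf (τ • e + c τ + t • e) ((τ + t) • e + c (τ + t))
      have h5 : ‖τ • e + c τ + t • e - ((τ + t) • e + c (τ + t))‖ ≤ 8 / N * |t| := by
        have e1 : τ • e + c τ + t • e - ((τ + t) • e + c (τ + t)) = c τ - c (τ + t) := by module
        have e2 := hclip τ (τ + t)
        rw [sub_add_cancel_left, abs_neg] at e2
        rw [e1]; exact e2
      have h6 : (f (τ • e + c τ + t • e) - f (τ • e + c τ)) - f (t • e) =
          (f (τ • e + c τ + t • e) - f ((τ + t) • e + c (τ + t))) + (g (τ + t) - g τ) -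
            (f (t • e) - fd * t) := by
        simp only [hg]; ring
      have h7 := mul_le_mul_of_nonneg_left h5 hL.le
      have h8 : L * (8 / N) * |t| ≤ T / 2 * |t| := by gcongr
      have h9 : σ * |t| ≤ T / 2 * |t| := by gcongr
      have h10 : 11 * Real.sqrt (3 * L * G) * |t| ≤ 11 * (1.7321 * T) * |t| := by gcongr
      rw [h6]
      refine (abs_sub _ _).trans ((add_le_add (abs_add_le _ _) le_rfl).trans ?_)
      have h11 : 0 ≤ T * |t| := mul_nonneg (hS0.le.trans hST) (abs_nonneg t)
      linarith only [h2, h3, h4, h7, h8, h9, h10, h11]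
    · have hx : ‖τ • e + c τ‖ ≤ 2 := by
        have e1 : ‖τ • e‖ ≤ 1 := by
          rw [norm_smul, he, mul_one, Real.norm_eq_abs]
          exact abs_le.2 ⟨hτ.1.le, hτ.2.le⟩
        have e2 : ‖c τ‖ ≤ 1 := by
          have h1 := hclip τ 1
          have h2 : |τ - 1| ≤ 2 := by rw [abs_le]; constructor <;> linarith [hτ.1, hτ.2]
          have h3 := norm_sub_norm_le (c τ) (c 1)
          have h4 : ‖c 1‖ ≤ η := by rw [hcr 1 le_rfl]; exact hp₂
          have h5 : 8 / N * |τ - 1| ≤ 8 / N * 2 := by gcongr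
          have h6 : 8 / N = 8 * (1 / N) := by ring
          linarith
        exact (norm_add_le _ _).trans (by linarith)
      have h1 := hf (τ • e + c τ + t • e) (t • e)
      rw [add_sub_cancel_right] at h1
      have h2 := hf (τ • e + c τ) 0
      rw [hf0, sub_zero, sub_zero] at h2
      have h3 := mul_le_mul_of_nonneg_left hx hL.le
      have h4 : (f (τ • e + c τ + t • e) - f (τ • e + c τ)) - f (t • e) =
        (f (τ • e + c τ + t • e) - f (t • e)) - f (τ • e + c τ) := by ring
      rw [h4]
      refine (abs_sub _ _).trans ?_
      have h5 : R * S ≤ |t| * T := mul_le_mul ht.le hST hS0.le (abs_nonneg _)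
      have h6 : 0 ≤ T * |t| := mul_nonneg (hS0.le.trans hST) (abs_nonneg t)
      rw [← hS] at hRL
      linarith only [h1, h2, h3, h5, h6, hRL]
  refine hgoal.trans (mul_le_mul_of_nonneg_right ?_ (abs_nonneg t))
  linarith only [hgainT, hS0, hST]

lemma lipConst_nonneg {H : Type*} [NormedAddCommGroup H] (f : H → ℝ) : 0 ≤ lipConst f :=
  Real.sInf_nonneg fun _ hK => hK.1

lemma abs_sub_le_lipConst_mul {H : Type*} [NormedAddCommGroup H] {f : H → ℝ}
    (hlip : ∃ K : NNReal, LipschitzWith K f) (x y : H) :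
    |f x - f y| ≤ lipConst f * ‖x - y‖ := by
  obtain ⟨K, hK⟩ := hlip
  rcases eq_or_ne x y with rfl | hxy
  · simp
  have hpos : 0 < ‖x - y‖ := norm_pos_iff.2 (sub_ne_zero.2 hxy)
  rw [← div_le_iff₀ hpos]
  refine le_csInf ⟨K, K.2, fun a b => ?_⟩ fun M hM => (div_le_iff₀ hpos).2 (hM.2 x y)
  simpa [Real.dist_eq, dist_eq_norm] using hK.dist_le_mul a b

lemma HasDirDeriv.le_of_lipschitz {H : Type*} [NormedAddCommGroup H] [NormedSpace ℝ H]
    {f : H → ℝ} {L : ℝ} (hf : ∀ y z, |f y - f z| ≤ L * ‖y - z‖) {x e : H} (he : ‖e‖ = 1) {d : ℝ}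
    (h : HasDirDeriv f x e d) : d ≤ L := by
  refine le_of_tendsto h (eventually_mem_nhdsWithin.mono fun t ht => ?_)
  refine (le_abs_self _).trans ?_
  rw [abs_div, div_le_iff₀ (abs_pos.2 ht)]
  simpa [norm_smul, he] using hf (x + t • e) x

/-- The blow-up of `f` at `x` at scale `δ` has the directional derivatives of `f`. -/
lemma HasDirDeriv.of_rescale {H : Type*} [NormedAddCommGroup H] [NormedSpace ℝ H]
    {f : H → ℝ} {x y e : H} {δ d : ℝ} (hδ : δ ≠ 0)
    (h : HasDirDeriv (fun w => (f (x + δ • w) - f x) / δ) y e d) :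
    HasDirDeriv f (x + δ • y) e d := by
  have h1 := h.smul δ⁻¹
  rw [hasDirDeriv_iff_hasDerivAt] at h1 ⊢
  have h2 := (h1.const_mul δ).add_const (f x)
  rw [mul_inv_cancel_left₀ hδ] at h2
  refine h2.congr_of_eventuallyEq (Eventually.of_forall fun t => ?_)
  simp only [smul_add, smul_smul]
  rw [mul_div_cancel₀ _ hδ, mul_left_comm, mul_inv_cancel₀ hδ, mul_one, sub_add_cancel, add_assoc]

lemma smul_add_mem_segment {H : Type*} [NormedAddCommGroup H] [NormedSpace ℝ H]
    (x : H) (δ : ℝ) {y a b : H} (h : y ∈ segment ℝ a b) :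
    x + δ • y ∈ segment ℝ (x + δ • a) (x + δ • b) := by
  obtain ⟨s, t, hs, ht, hst, rfl⟩ := h
  refine ⟨s, t, hs, ht, hst, ?_⟩
  obtain rfl : s = 1 - t := by linarith
  module

theorem stmt14 {H : Type*} [NormedAddCommGroup H] [InnerProductSpace ℝ H] [CompleteSpace H]
    (f : H → ℝ) (hlip : ∃ K : NNReal, LipschitzWith K f)
    (x e : H) (he : ‖e‖ = 1)
    (fd : ℝ) (hfd : HasDirDeriv f x e fd) (hfd0 : 0 ≤ fd)
    (F : ℝ → Set H)
    (h1 : ∀ ε > (0 : ℝ), ∀ η > (0 : ℝ), ∃ δstar > (0 : ℝ), ∀ δ ∈ Set.Ioo 0 δstar,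
      ∀ u₁ u₂ u₃ : H, ‖u₁‖ ≤ 1 → ‖u₂‖ ≤ 1 → ‖u₃‖ ≤ 1 →
      ∃ u₁' u₂' u₃' : H, ‖u₁' - u₁‖ ≤ η ∧ ‖u₂' - u₂‖ ≤ η ∧ ‖u₃' - u₃‖ ≤ η ∧
        segment ℝ (x + δ • u₁') (x + δ • u₃') ∪ segment ℝ (x + δ • u₃') (x + δ • u₂')
          ⊆ F ε)
    (h2 : ∀ ε > (0 : ℝ), ∀ x' ∈ F ε, ∀ e' : H, ‖e'‖ = 1 → ∀ fd' : ℝ,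
      HasDirDeriv f x' e' fd' → fd ≤ fd' →
      (∀ t : ℝ, |(f (x' + t • e) - f x') - (f (x + t • e) - f x)| ≤
        25 * Real.sqrt ((fd' - fd) * lipConst f) * |t|) →
      fd' < fd + ε) :
    HasFDerivAt f (fd • (innerSL ℝ e)) x := by
  obtain ⟨L, hLdef⟩ : ∃ L, L = lipConst f := ⟨_, rfl⟩
  have hf : ∀ y z, |f y - f z| ≤ L * ‖y - z‖ := by
    rw [hLdef]; exact abs_sub_le_lipConst_mul hlip
  rw [← hLdef] at h2
  have hfdL := hfd.le_of_lipschitz hf he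
  rw [hasFDerivAt_iff_isLittleO_nhds_zero, Asymptotics.isLittleO_iff]
  by_contra! hcon
  obtain ⟨ε, hε, hfreq⟩ := hcon
  replace hfreq : ∃ᶠ h in nhds (0 : H),
      ε * ‖h‖ < |f (x + h) - f x - fd * inner ℝ e h| := by
    refine hfreq.mono fun h hh => ?_
    simpa only [Real.norm_eq_abs, smul_apply, innerSL_apply_apply,
      smul_eq_mul] using hh
  have hL0 : 0 ≤ L := hLdef ▸ lipConst_nonneg f
  rcases hL0.eq_or_lt with hL | hL
  · obtain ⟨h, hh⟩ := hfreq.exists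
    have h3 := hf (x + h) x
    obtain rfl : fd = 0 := by linarith
    rw [← hL, zero_mul] at h3
    rw [zero_mul, sub_zero] at hh
    nlinarith [norm_nonneg h]
  obtain ⟨N, hN⟩ : ∃ N, N = 100 + 1000000 * L / ε := ⟨_, rfl⟩
  have hN100 : 100 ≤ N := by rw [hN]; have : 0 ≤ 1000000 * L / ε := by positivity
                             linarith
  have hN0 : 0 < N := by linarith
  have hNL : 1000000 * L ≤ ε * N := by
    rw [hN, mul_add, mul_div_cancel₀ _ hε.ne']; linarith
  obtain ⟨θ, hθ⟩ : ∃ θ, θ = ε / (200 * N) := ⟨_, rfl⟩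
  have hθ0 : 0 < θ := by rw [hθ]; positivity
  obtain ⟨κ, hκ0, hκ1, hκ2⟩ : ∃ κ > 0, 2 * κ ≤ θ ∧ 18 * L * κ ≤ θ * Real.sqrt (3 * L * θ) := by
    refine ⟨min (θ / 2) (θ * Real.sqrt (3 * L * θ) / (18 * L)), by positivity, ?_, ?_⟩
    · linarith [min_le_left (θ / 2) (θ * Real.sqrt (3 * L * θ) / (18 * L))]
    · rw [mul_comm, ← le_div_iff₀ (by positivity)]
      exact min_le_right _ _
  obtain ⟨η, hη0, hη1, hη2⟩ : ∃ η > 0, 4 * η ≤ 1 / N ^ 2 ∧ L * η ≤ κ := by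
    refine ⟨min (1 / N ^ 2 / 4) (κ / L), by positivity, ?_, ?_⟩
    · linarith [min_le_left (1 / N ^ 2 / 4) (κ / L)]
    · rw [mul_comm, ← le_div_iff₀ hL]
      exact min_le_right _ _
  obtain ⟨S, hS⟩ : ∃ S, S = Real.sqrt (L * θ) := ⟨_, rfl⟩
  have hS0 : 0 < S := by rw [hS]; positivity
  obtain ⟨σ, hσ0, hσ1, hσ2⟩ : ∃ σ > 0, σ ≤ κ ∧ σ ≤ S / 2 :=
    ⟨min κ (S / 2), by positivity, min_le_left _ _, min_le_right _ _⟩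
  obtain ⟨R, hR⟩ : ∃ R, R = 4 * L / S := ⟨_, rfl⟩
  have hR0 : 0 ≤ R := by rw [hR]; positivity
  obtain ⟨δstar, hδstar, hF⟩ := h1 (4 / 5 * θ) (by positivity) η hη0
  obtain ⟨r, hr0, hr⟩ : ∃ r > 0, ∀ t : ℝ, |t| < r → |f (x + t • e) - f x - fd * t| ≤ σ * |t| := by
    have h3 := hasDirDeriv_iff_hasDerivAt.1 hfd
    rw [hasDerivAt_iff_isLittleO_nhds_zero, Asymptotics.isLittleO_iff] at h3
    obtain ⟨r, hr0, hr⟩ := Metric.eventually_nhds_iff.1 (h3 hσ0)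
    refine ⟨r, hr0, fun t ht => ?_⟩
    simpa [mul_comm] using hr (y := t) (by simpa using ht)
  have hsmall : ∀ᶠ h in nhds (0 : H), N * ‖h‖ < δstar ∧ N * ‖h‖ * (R + 1) < r := by
    have h3 : Tendsto (fun h : H => N * ‖h‖) (nhds 0) (nhds 0) := by
      have : Continuous fun h : H => N * ‖h‖ := by fun_prop
      simpa using this.tendsto 0
    have h4 : Tendsto (fun h : H => N * ‖h‖ * (R + 1)) (nhds 0) (nhds 0) := by
      simpa using h3.mul_const (R + 1)
    exact (h3.eventually_lt_const hδstar).and (h4.eventually_lt_const hr0)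
  obtain ⟨h, hh, hhδ, hhr⟩ := (hfreq.and_eventually hsmall).exists
  have hh0 : 0 < ‖h‖ := by
    rw [norm_pos_iff]
    rintro rfl
    simp at hh
  obtain ⟨δ, hδ⟩ : ∃ δ, δ = N * ‖h‖ := ⟨_, rfl⟩
  rw [← hδ] at hhδ hhr
  have hδ0 : 0 < δ := by rw [hδ]; positivity
  obtain ⟨z, hz⟩ : ∃ z, z = δ⁻¹ • h := ⟨_, rfl⟩
  have hhz : h = δ • z := by rw [hz, smul_inv_smul₀ hδ0.ne']
  have hzN : ‖z‖ = 1 / N := by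
    rw [hz, norm_smul, norm_inv, Real.norm_of_nonneg hδ0.le, hδ]
    field_simp
  have hN1 : 1 / N ≤ 1 := by rw [div_le_one hN0]; linarith
  obtain ⟨p₁, p₂, p₃, hp₁, hp₂, hp₃, hpF⟩ := hF δ ⟨hδ0, hhδ⟩ (-e) e z (by simp [he]) he.le
    (hzN.trans_le hN1)
  obtain ⟨g, hg⟩ : ∃ g : H → ℝ, g = fun w => (f (x + δ • w) - f x) / δ := ⟨_, rfl⟩
  have hgL : ∀ y z, |g y - g z| ≤ L * ‖y - z‖ := by
    intro y z
    have h3 := hf (x + δ • y) (x + δ • z)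
    rw [add_sub_add_left_eq_sub, ← smul_sub, norm_smul, Real.norm_of_nonneg hδ0.le] at h3
    rw [hg, ← sub_div, sub_sub_sub_cancel_right, abs_div, abs_of_pos hδ0, div_le_iff₀ hδ0]
    linarith
  have hgapp : ∀ t : ℝ, |t| ≤ R + 1 → |g (t • e) - fd * t| ≤ σ * |t| := by
    intro t ht
    have h3 := hr (δ * t) (by
      rw [abs_mul, abs_of_pos hδ0]
      exact (mul_le_mul_of_nonneg_left ht hδ0.le).trans_lt hhr)
    have h4 : g (t • e) - fd * t = (f (x + (δ * t) • e) - f x - fd * (δ * t)) / δ := by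
      rw [hg]; simp only [smul_smul]; field_simp
    rw [abs_mul, abs_of_pos hδ0] at h3
    rw [h4, abs_div, abs_of_pos hδ0, div_le_iff₀ hδ0]
    linarith
  have hgz : ε / N ≤ |g z - fd * inner ℝ e z| := by
    have h4 : g z - fd * inner ℝ e z = (f (x + h) - f x - fd * inner ℝ e h) / δ := by
      rw [hg, hhz, inner_smul_right]; field_simp
    rw [h4, abs_div, abs_of_pos hδ0, le_div_iff₀ hδ0, hδ]
    refine le_trans (le_of_eq ?_) hh.le
    field_simp
  have hLη : L * η ≤ ε / (2 * N) := by
    have h3 : ε / (2 * N) = 100 * θ := by rw [hθ]; field_simp; norm_num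
    linarith
  obtain ⟨x', hx', e', he', fd', hd, hgain, hinc⟩ := exists_larger_dirDeriv hL hgL
    (by simp [hg]) he hfd0 hfdL hε hN100 hNL hθ hη0.le hη1 hLη hσ0.le
    (by linarith) (by nlinarith) (hS ▸ hσ2) hR0
    (by rw [← hS, hR, div_mul_cancel₀ _ hS0.ne']) hgapp hzN.le hgz hp₁ hp₂ hp₃
  have hxF : x + δ • x' ∈ F (4 / 5 * θ) :=
    hpF (hx'.imp (smul_add_mem_segment x δ) (smul_add_mem_segment x δ))
  refine (h2 (4 / 5 * θ) (by positivity) _ hxF e' he' fd' ((hg ▸ hd).of_rescale hδ0.ne')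
    (by linarith) fun t => ?_).not_ge hgain
  have h3 := hinc (t / δ)
  have h4 : g (x' + (t / δ) • e) - g x' - g ((t / δ) • e) =
      ((f (x + δ • x' + t • e) - f (x + δ • x')) - (f (x + t • e) - f x)) / δ := by
    rw [hg]
    simp only [smul_add, smul_smul, mul_div_cancel₀ _ hδ0.ne', add_assoc]
    ring
  rwa [h4, abs_div, abs_div, abs_of_pos hδ0, mul_div_assoc', div_le_div_iff_of_pos_right hδ0] at h3
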